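/- Let 𝒮 be a set of symmetric, pairwise commuting real n×n matrices with 0 ≼ S ≼ Iₙ for every S ∈ 𝒮, let Ŝ, S_μ ∈ 𝒮, and let Ĝ : 𝒮 → ℝ be any function with Ĝ(Ŝ) ≤ Ĝ(S_μ). Set m* := M_μ(S_μ), fix x > 0, and let r_x := max(√(3m*), 7x) and L(S, x) := [d²(S, S_μ) + r_x²]·x / r_x. If |D̂(S) − D̂(S_μ)| ≤ L(S, x) for all S ∈ 𝒮, where D̂(S) := Ĝ(S) − M_μ(S), then d(Ŝ, S_μ) < r_x and M_μ(Ŝ) ≤ m* + 2x·r_x. -/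

import Mathlib

open Matrix

/-- `M_μ(S) := μᵀ(I−S)²μ + σ²·tr(S²)`. -/
noncomputable def Mmu {n : ℕ} (μ : Fin n → ℝ) (σ : ℝ)
    (S : Matrix (Fin n) (Fin n) ℝ) : ℝ :=
  μ ⬝ᵥ ((1 - S) ^ 2).mulVec μ + σ ^ 2 * (S ^ 2).trace

/-- `d²(S₁,S₂) := μᵀ(S₁−S₂)²μ + σ²·tr((S₁−S₂)²)`. -/
noncomputable def dSq {n : ℕ} (μ : Fin n → ℝ) (σ : ℝ)
    (S₁ S₂ : Matrix (Fin n) (Fin n) ℝ) : ℝ :=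
  μ ⬝ᵥ ((S₁ - S₂) ^ 2).mulVec μ + σ ^ 2 * ((S₁ - S₂) ^ 2).trace

/-- `d(S₁,S₂) := √(d²(S₁,S₂))`. -/
noncomputable def dDist {n : ℕ} (μ : Fin n → ℝ) (σ : ℝ)
    (S₁ S₂ : Matrix (Fin n) (Fin n) ℝ) : ℝ :=
  Real.sqrt (dSq μ σ S₁ S₂)

open scoped MatrixOrder in
lemma posSemidef_mul_of_comm {n : ℕ} {A B : Matrix (Fin n) (Fin n) ℝ}
    (hA : A.PosSemidef) (hB : B.PosSemidef) (h : A * B = B * A) : (A * B).PosSemidef :=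
  (Commute.mul_nonneg hA.nonneg hB.nonneg h).posSemidef

lemma dSq_le_add {n : ℕ} (μ : Fin n → ℝ) (σ : ℝ) {A B : Matrix (Fin n) (Fin n) ℝ}
    (hA : A.PosSemidef) (hB : B.PosSemidef) (hA1 : (1 - A).PosSemidef)
    (hB1 : (1 - B).PosSemidef) (h : A * B = B * A) :
    dSq μ σ A B ≤ Mmu μ σ A + Mmu μ σ B := by
  have h1 := (posSemidef_mul_of_comm hA hB h).trace_nonneg
  have h2 := (posSemidef_mul_of_comm hA1 hB1
    (by simp only [mul_sub, sub_mul, h, mul_one, one_mul]; abel)).dotProduct_mulVec_nonneg μ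
  rw [star_trivial] at h2
  have e1 : (A - B) ^ 2 = A ^ 2 + B ^ 2 - (A * B + A * B) := by
    simp only [pow_two, mul_sub, sub_mul, h]; abel
  have e2 : (A - B) ^ 2
      = (1 - A) ^ 2 + (1 - B) ^ 2 - ((1 - A) * (1 - B) + (1 - A) * (1 - B)) := by
    simp only [pow_two, mul_sub, sub_mul, h, mul_one, one_mul]; abel
  have t1 : ((A - B) ^ 2).trace ≤ (A ^ 2).trace + (B ^ 2).trace := by
    rw [e1, trace_sub, trace_add, trace_add]; linarith
  have t2 : μ ⬝ᵥ ((A - B) ^ 2).mulVec μ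
      ≤ μ ⬝ᵥ ((1 - A) ^ 2).mulVec μ + μ ⬝ᵥ ((1 - B) ^ 2).mulVec μ := by
    rw [e2, sub_mulVec, add_mulVec, add_mulVec, dotProduct_sub, dotProduct_add, dotProduct_add]
    linarith
  have t3 := mul_le_mul_of_nonneg_left t1 (sq_nonneg σ)
  unfold dSq Mmu
  linarith

/-- Deterministic part of the proof of the main theorem: if `Ŝ` minimizes `Ĝ` over a
totally commuting family `𝒮` of symmetric matrices with `0 ≼ S ≼ I`, and the
fluctuations `D̂(S) := Ĝ(S) − M_μ(S)` satisfy `|D̂(S) − D̂(S_μ)| ≤ L(S,x)` on `𝒮`,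
where `L(S,x) = (d²(S,S_μ) + r_x²)·x / r_x` and `r_x = max(√(3m*), 7x)`, then
`d(Ŝ, S_μ) < r_x` and `M_μ(Ŝ) ≤ m* + 2 x r_x`. -/
theorem dist_lt_and_Mmu_le {n : ℕ} (μ : Fin n → ℝ) (σ : ℝ) (hσ : 0 < σ)
    (𝒮 : Set (Matrix (Fin n) (Fin n) ℝ))
    (hpsd : ∀ S ∈ 𝒮, S.PosSemidef) (hle : ∀ S ∈ 𝒮, ((1 : Matrix (Fin n) (Fin n) ℝ) - S).PosSemidef)
    (hcomm : ∀ S₁ ∈ 𝒮, ∀ S₂ ∈ 𝒮, S₁ * S₂ = S₂ * S₁)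
    (Shat Sμ : Matrix (Fin n) (Fin n) ℝ) (hShat : Shat ∈ 𝒮) (hSμ : Sμ ∈ 𝒮)
    (Ghat : Matrix (Fin n) (Fin n) ℝ → ℝ) (hmin : Ghat Shat ≤ Ghat Sμ)
    (x : ℝ) (hx : 0 < x)
    (hL : ∀ S ∈ 𝒮,
      |(Ghat S - Mmu μ σ S) - (Ghat Sμ - Mmu μ σ Sμ)| ≤
        (dSq μ σ S Sμ + (max (Real.sqrt (3 * Mmu μ σ Sμ)) (7 * x)) ^ 2) * x /
          max (Real.sqrt (3 * Mmu μ σ Sμ)) (7 * x)) :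
    dDist μ σ Shat Sμ < max (Real.sqrt (3 * Mmu μ σ Sμ)) (7 * x) ∧
      Mmu μ σ Shat ≤ Mmu μ σ Sμ + 2 * x * max (Real.sqrt (3 * Mmu μ σ Sμ)) (7 * x) := by
  have hd := dSq_le_add μ σ (hpsd _ hShat) (hpsd _ hSμ) (hle _ hShat) (hle _ hSμ)
    (hcomm _ hShat _ hSμ)
  have hl := (abs_le.mp (hL _ hShat)).1
  have hr1 := le_max_left (Real.sqrt (3 * Mmu μ σ Sμ)) (7 * x)
  have hr2 := le_max_right (Real.sqrt (3 * Mmu μ σ Sμ)) (7 * x)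
  unfold dDist
  generalize max (Real.sqrt (3 * Mmu μ σ Sμ)) (7 * x) = r at *
  have hr : 0 < r := by linarith
  have hm : 3 * Mmu μ σ Sμ ≤ r ^ 2 := (Real.sqrt_le_left hr.le).mp hr1
  generalize dSq μ σ Shat Sμ = d at *
  have hM : Mmu μ σ Shat - Mmu μ σ Sμ ≤ (d + r ^ 2) * x / r := by linarith
  have hdr : d < r ^ 2 := by
    by_contra hcon
    push Not at hcon
    have hp : 0 < r ^ 2 := by positivity
    have : (d + r ^ 2) * x / r ≤ (d + r ^ 2) / 7 := by
      rw [div_le_div_iff₀ hr (by norm_num)]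
      nlinarith
    linarith
  refine ⟨(Real.sqrt_lt' hr).mpr hdr, ?_⟩
  have : (d + r ^ 2) * x / r ≤ 2 * x * r := by
    rw [div_le_iff₀ hr]
    nlinarith
  linarith
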